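/- (Proposition C.9, Lipschitz continuity of the value functions.) For every 0 ≤ n ≤ N and all π, π̃ ∈ M_1 one has |v_n(π) − v_n(π̃)| ≤ (2^{N−n+2} − 3) C_g |π − π̃|, where (v_n)_{0≤n≤N} is the dynamic programming sequence defined by v_N(π) = Σ_{i=1}^q g_i(0) π^i and v_{n−1} = L(v_n, g). -/

import Mathlib

open MeasureTheory Finset

noncomputable section

namespace PDMP

/-- Integrated jump rate `Λ_i(t) = ∫_0^t λ_i(s) ds`. -/
def Lam (lam : ℕ → ℝ → ℝ) (i : ℕ) (t : ℝ) : ℝ := ∫ s in (0:ℝ)..t, lam i s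

/-- The unnormalized filter density `Ψ_m^j(π,y,s)`. -/
def psiNum (q d : ℕ) (ts : ℕ → ℝ) (lam : ℕ → ℝ → ℝ) (Q : ℕ → ℕ → ℝ → ℝ)
    (fW : (Fin d → ℝ) → ℝ) (phi : ℕ → Fin d → ℝ)
    (m : ℕ) (p : ℕ → ℝ) (y : Fin d → ℝ) (s : ℝ) (j : ℕ) : ℝ :=
  ∑ i ∈ Finset.Icc (m + 1) q,
    p i * lam i s * Real.exp (-(Lam lam i s)) * Q i j s * fW (y - phi j)

/-- `Ψ̄_m(π,y,s) = Σ_k Ψ_m^k(π,y,s)`. -/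
def psiBar (q d : ℕ) (ts : ℕ → ℝ) (lam : ℕ → ℝ → ℝ) (Q : ℕ → ℕ → ℝ → ℝ)
    (fW : (Fin d → ℝ) → ℝ) (phi : ℕ → Fin d → ℝ)
    (m : ℕ) (p : ℕ → ℝ) (y : Fin d → ℝ) (s : ℝ) : ℝ :=
  ∑ k ∈ Finset.Icc 1 q, psiNum q d ts lam Q fW phi m p y s k

open Classical in
/-- The filter update `Ψ(π,y,s)`. -/
def Psi (q d : ℕ) (ts : ℕ → ℝ) (lam : ℕ → ℝ → ℝ) (Q : ℕ → ℕ → ℝ → ℝ)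
    (fW : (Fin d → ℝ) → ℝ) (phi : ℕ → Fin d → ℝ)
    (p : ℕ → ℝ) (y : Fin d → ℝ) (s : ℝ) : ℕ → ℝ :=
  if ∃ m, 1 ≤ m ∧ m ≤ q ∧ s = ts m then
    let m := sInf {m | 1 ≤ m ∧ m ≤ q ∧ s = ts m}
    if 0 < ∑ k ∈ Finset.Icc 1 q, Q m k (ts m) * fW (y - phi k) then
      fun j => Q m j (ts m) * fW (y - phi j) /
        (∑ k ∈ Finset.Icc 1 q, Q m k (ts m) * fW (y - phi k))
    else p
  else if ∃ m, m < q ∧ ts m < s ∧ s < ts (m + 1) then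
    let m := sInf {m | m < q ∧ ts m < s ∧ s < ts (m + 1)}
    if 0 < psiBar q d ts lam Q fW phi m p y s then
      fun j => psiNum q d ts lam Q fW phi m p y s j / psiBar q d ts lam Q fW phi m p y s
    else p
  else p

/-- ℓ¹ distance on `ℝ^q` (coordinates `1,…,q`). -/
def l1 (q : ℕ) (p p' : ℕ → ℝ) : ℝ := ∑ i ∈ Finset.Icc 1 q, |p i - p' i|

/-- Membership in the probability simplex `M_1`. -/
def mem1 (q : ℕ) (p : ℕ → ℝ) : Prop :=
  (∀ i ∈ Finset.Icc 1 q, 0 ≤ p i) ∧ ∑ i ∈ Finset.Icc 1 q, p i = 1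

/-- The operator `I`. -/
def Iop (q d : ℕ) (ts : ℕ → ℝ) (lam : ℕ → ℝ → ℝ) (Q : ℕ → ℕ → ℝ → ℝ)
    (fW : (Fin d → ℝ) → ℝ) (phi : ℕ → Fin d → ℝ)
    (v : (ℕ → ℝ) → ℝ) (p : ℕ → ℝ) (u : ℝ) : ℝ :=
  ∑ i ∈ Finset.Icc 1 q, p i *
    ∫ s in (0:ℝ)..(min u (ts i)),
      lam i s * Real.exp (-(Lam lam i s)) *
        ∫ y : Fin d → ℝ,
          v (Psi q d ts lam Q fW phi p y s) *
            ∑ j ∈ Finset.Icc 1 q, Q i j s * fW (y - phi j)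

/-- Boundary (forced-jump) term appearing in the operator `G`. -/
def bTerm (q d : ℕ) (ts : ℕ → ℝ) (lam : ℕ → ℝ → ℝ) (Q : ℕ → ℕ → ℝ → ℝ)
    (fW : (Fin d → ℝ) → ℝ) (phi : ℕ → Fin d → ℝ)
    (v : (ℕ → ℝ) → ℝ) (p : ℕ → ℝ) (i : ℕ) : ℝ :=
  p i * Real.exp (-(Lam lam i (ts i))) *
    ∫ y : Fin d → ℝ,
      v (Psi q d ts lam Q fW phi p y (ts i)) *
        ∑ j ∈ Finset.Icc 1 q, Q i j (ts i) * fW (y - phi j)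

/-- The operator `G`. -/
def Gop (q d : ℕ) (ts : ℕ → ℝ) (lam : ℕ → ℝ → ℝ) (Q : ℕ → ℕ → ℝ → ℝ)
    (fW : (Fin d → ℝ) → ℝ) (phi : ℕ → Fin d → ℝ)
    (v : (ℕ → ℝ) → ℝ) (p : ℕ → ℝ) (u : ℝ) : ℝ :=
  Iop q d ts lam Q fW phi v p u +
    ∑ i ∈ Finset.Icc 1 q, if ts i ≤ u then bTerm q d ts lam Q fW phi v p i else 0

/-- The operator `H`. -/
def Hop (q : ℕ) (ts : ℕ → ℝ) (lam : ℕ → ℝ → ℝ)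
    (g : ℕ → ℝ → ℝ) (p : ℕ → ℝ) (u : ℝ) : ℝ :=
  ∑ i ∈ Finset.Icc 1 q, if u < ts i then p i * Real.exp (-(Lam lam i u)) * g i u else 0

/-- The operator `J`. -/
def Jop (q d : ℕ) (ts : ℕ → ℝ) (lam : ℕ → ℝ → ℝ) (Q : ℕ → ℕ → ℝ → ℝ)
    (fW : (Fin d → ℝ) → ℝ) (phi : ℕ → Fin d → ℝ)
    (v : (ℕ → ℝ) → ℝ) (g : ℕ → ℝ → ℝ) (p : ℕ → ℝ) (u : ℝ) : ℝ :=
  Hop q ts lam g p u + Gop q d ts lam Q fW phi v p u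

/-- The operator `K`. -/
def Kop (q d : ℕ) (ts : ℕ → ℝ) (lam : ℕ → ℝ → ℝ) (Q : ℕ → ℕ → ℝ → ℝ)
    (fW : (Fin d → ℝ) → ℝ) (phi : ℕ → Fin d → ℝ)
    (v : (ℕ → ℝ) → ℝ) (p : ℕ → ℝ) : ℝ :=
  Gop q d ts lam Q fW phi v p (ts q)

/-- The dynamic programming operator `L(v,g)(π) = sup_{u ≥ 0} J(v,g)(π,u)`. -/
def Lop (q d : ℕ) (ts : ℕ → ℝ) (lam : ℕ → ℝ → ℝ) (Q : ℕ → ℕ → ℝ → ℝ)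
    (fW : (Fin d → ℝ) → ℝ) (phi : ℕ → Fin d → ℝ)
    (v : (ℕ → ℝ) → ℝ) (g : ℕ → ℝ → ℝ) (p : ℕ → ℝ) : ℝ :=
  ⨆ u : Set.Ici (0:ℝ), Jop q d ts lam Q fW phi v g p u.1

/-- The operator `H^m`. -/
def Hm (q : ℕ) (ts : ℕ → ℝ) (lam : ℕ → ℝ → ℝ) (m : ℕ)
    (g : ℕ → ℝ → ℝ) (p : ℕ → ℝ) (u : ℝ) : ℝ :=
  if u < ts m then Hop q ts lam g p (ts m)
  else ∑ i ∈ Finset.Icc (m + 1) q,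
    p i * Real.exp (-(Lam lam i (min u (ts (m + 1))))) * g i (min u (ts (m + 1)))

/-- The operator `G^m`. -/
def Gm (q d : ℕ) (ts : ℕ → ℝ) (lam : ℕ → ℝ → ℝ) (Q : ℕ → ℕ → ℝ → ℝ)
    (fW : (Fin d → ℝ) → ℝ) (phi : ℕ → Fin d → ℝ) (m : ℕ)
    (v : (ℕ → ℝ) → ℝ) (p : ℕ → ℝ) (u : ℝ) : ℝ :=
  if u < ts m then Gop q d ts lam Q fW phi v p (ts m)
  else Iop q d ts lam Q fW phi v p (min u (ts (m + 1))) +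
    ∑ i ∈ Finset.Icc 1 m, bTerm q d ts lam Q fW phi v p i

/-- The discretization grid `Gr_m(Δ)`. -/
def grid (ts : ℕ → ℝ) (Δ : ℝ) (m : ℕ) : Set ℝ :=
  {u | (∃ i : ℕ, 1 ≤ i ∧ ts m + i * Δ ≤ ts (m + 1) - Δ ∧ u = ts m + i * Δ) ∨
    u = ts (m + 1) - Δ}


/-- Standing hypotheses, bundled for the helper lemmas. -/
structure Hyp (q d : ℕ) (ts : ℕ → ℝ) (Clam : ℝ) (lam : ℕ → ℝ → ℝ) (Q : ℕ → ℕ → ℝ → ℝ)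
    (fW : (Fin d → ℝ) → ℝ) : Prop where
  hq : 1 ≤ q
  hts0 : ts 0 = 0
  hts1 : 0 < ts 1
  htsmono : ∀ i, i < q → ts i ≤ ts (i + 1)
  hClam : 0 ≤ Clam
  hlam_meas : ∀ i, Measurable (lam i)
  hlam_bd : ∀ i s, 0 ≤ s → lam i s ∈ Set.Icc 0 Clam
  hQ_meas : ∀ i j, Measurable (Q i j)
  hQ_bd : ∀ i j s, 0 ≤ s → Q i j s ∈ Set.Icc (0:ℝ) 1
  hQ_sum : ∀ i s, 0 ≤ s → ∑ j ∈ Finset.Icc 1 q, Q i j s = 1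
  hfW_meas : Measurable fW
  hfW_nonneg : ∀ y, 0 ≤ fW y
  hfW_int : ∫ y : Fin d → ℝ, fW y = 1

/-- The jump-time density, cut off at the exit time. -/
def rate (ts : ℕ → ℝ) (lam : ℕ → ℝ → ℝ) (i : ℕ) (s : ℝ) : ℝ :=
  (Set.Ioo 0 (ts i)).indicator (fun s => lam i s * Real.exp (-(Lam lam i s))) s

/-- Mark density. -/
def mkd (q d : ℕ) (Q : ℕ → ℕ → ℝ → ℝ) (fW : (Fin d → ℝ) → ℝ) (phi : ℕ → Fin d → ℝ)
    (i : ℕ) (s : ℝ) (y : Fin d → ℝ) : ℝ :=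
  ∑ j ∈ Finset.Icc 1 q, Q i j s * fW (y - phi j)

/-- Unnormalized filter. -/
def An (q d : ℕ) (ts : ℕ → ℝ) (lam : ℕ → ℝ → ℝ) (Q : ℕ → ℕ → ℝ → ℝ)
    (fW : (Fin d → ℝ) → ℝ) (phi : ℕ → Fin d → ℝ)
    (p : ℕ → ℝ) (y : Fin d → ℝ) (s : ℝ) (j : ℕ) : ℝ :=
  ∑ i ∈ Finset.Icc 1 q, p i * rate ts lam i s * Q i j s * fW (y - phi j)

/-- Total mass of the unnormalized filter. -/
def At (q d : ℕ) (ts : ℕ → ℝ) (lam : ℕ → ℝ → ℝ) (Q : ℕ → ℕ → ℝ → ℝ)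
    (fW : (Fin d → ℝ) → ℝ) (phi : ℕ → Fin d → ℝ)
    (p : ℕ → ℝ) (y : Fin d → ℝ) (s : ℝ) : ℝ :=
  ∑ j ∈ Finset.Icc 1 q, An q d ts lam Q fW phi p y s j

open Classical in
/-- Normalized filter. -/
def Bn (q d : ℕ) (ts : ℕ → ℝ) (lam : ℕ → ℝ → ℝ) (Q : ℕ → ℕ → ℝ → ℝ)
    (fW : (Fin d → ℝ) → ℝ) (phi : ℕ → Fin d → ℝ)
    (p : ℕ → ℝ) (y : Fin d → ℝ) (s : ℝ) (j : ℕ) : ℝ :=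
  if 0 < At q d ts lam Q fW phi p y s then
    An q d ts lam Q fW phi p y s j / At q d ts lam Q fW phi p y s else p j

section helpers

variable {q d : ℕ} {ts : ℕ → ℝ} {Clam : ℝ} {lam : ℕ → ℝ → ℝ} {Q : ℕ → ℕ → ℝ → ℝ}
    {fW : (Fin d → ℝ) → ℝ} {phi : ℕ → Fin d → ℝ}

lemma Hyp.ts_mono (h : Hyp q d ts Clam lam Q fW) {i j : ℕ} (hij : i ≤ j) (hj : j ≤ q) :
    ts i ≤ ts j := by
  induction j, hij using Nat.le_induction with
  | base => exact le_rfl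
  | succ k hk ih => exact (ih (by omega)).trans (h.htsmono k (by omega))

lemma Hyp.ts_pos (h : Hyp q d ts Clam lam Q fW) {i : ℕ} (hi : i ∈ Finset.Icc 1 q) :
    0 < ts i := by
  rw [Finset.mem_Icc] at hi
  exact h.hts1.trans_le (h.ts_mono hi.1 hi.2)

lemma Hyp.lamInd_int (h : Hyp q d ts Clam lam Q fW) (i : ℕ) (a b : ℝ) :
    IntervalIntegrable ((Set.Ici (0:ℝ)).indicator (lam i)) volume a b := by
  rw [intervalIntegrable_iff]
  refine Measure.integrableOn_of_bounded (M := Clam) (by simp) ?_ ?_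
  · exact ((h.hlam_meas i).indicator measurableSet_Ici).aestronglyMeasurable
  · refine Filter.Eventually.of_forall fun x => ?_
    by_cases hx : 0 ≤ x
    · have := h.hlam_bd i x hx
      simp [Set.indicator, hx, abs_of_nonneg this.1, this.2]
    · simp [Set.indicator, hx, h.hClam]

lemma Hyp.Lam_eq (h : Hyp q d ts Clam lam Q fW) (i : ℕ) {t : ℝ} (ht : 0 ≤ t) :
    Lam lam i t = ∫ s in (0:ℝ)..t, (Set.Ici (0:ℝ)).indicator (lam i) s := by
  unfold Lam
  refine intervalIntegral.integral_congr fun x hx => ?_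
  rw [Set.uIcc_of_le ht] at hx
  simp [Set.indicator, hx.1]

lemma Hyp.Lam_nonneg (h : Hyp q d ts Clam lam Q fW) (i : ℕ) {t : ℝ} (ht : 0 ≤ t) :
    0 ≤ Lam lam i t :=
  intervalIntegral.integral_nonneg ht fun x hx => (h.hlam_bd i x hx.1).1

lemma Hyp.exp_le (h : Hyp q d ts Clam lam Q fW) (i : ℕ) {t : ℝ} (ht : 0 ≤ t) :
    Real.exp (-(Lam lam i t)) ≤ 1 := by
  have := h.Lam_nonneg i ht
  simpa using this

lemma Hyp.rate_nonneg (h : Hyp q d ts Clam lam Q fW) (i : ℕ) (s : ℝ) :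
    0 ≤ rate ts lam i s := by
  unfold rate
  refine Set.indicator_nonneg (fun x hx => ?_) s
  exact mul_nonneg (h.hlam_bd i x hx.1.le).1 (Real.exp_pos _).le

lemma Hyp.rate_le (h : Hyp q d ts Clam lam Q fW) (i : ℕ) (s : ℝ) :
    rate ts lam i s ≤ Clam := by
  unfold rate
  by_cases hs : s ∈ Set.Ioo 0 (ts i)
  · rw [Set.indicator_of_mem hs]
    have h1 := h.hlam_bd i s hs.1.le
    have h2 := h.exp_le i hs.1.le
    calc _ ≤ lam i s * 1 := mul_le_mul_of_nonneg_left h2 h1.1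
      _ ≤ Clam := by simpa using h1.2
  · rw [Set.indicator_of_notMem hs]; exact h.hClam

lemma Hyp.rate_meas (h : Hyp q d ts Clam lam Q fW) (i : ℕ) :
    Measurable (rate ts lam i) := by
  have hc : Continuous fun t => ∫ s in (0:ℝ)..t, (Set.Ici (0:ℝ)).indicator (lam i) s :=
    intervalIntegral.continuous_primitive (h.lamInd_int i) 0
  have : rate ts lam i = (Set.Ioo 0 (ts i)).indicator (fun s => lam i s *
      Real.exp (-(∫ s in (0:ℝ)..s, (Set.Ici (0:ℝ)).indicator (lam i) s))) := by
    funext s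
    unfold rate
    by_cases hs : s ∈ Set.Ioo 0 (ts i)
    · rw [Set.indicator_of_mem hs, Set.indicator_of_mem hs, h.Lam_eq i hs.1.le]
    · rw [Set.indicator_of_notMem hs, Set.indicator_of_notMem hs]
  rw [this]
  exact ((h.hlam_meas i).mul (Real.measurable_exp.comp hc.measurable.neg)).indicator
    measurableSet_Ioo

lemma Hyp.rate_integrable (h : Hyp q d ts Clam lam Q fW) (i : ℕ) (u : ℝ) :
    IntegrableOn (rate ts lam i) (Set.Ioc 0 u) := by
  refine Measure.integrableOn_of_bounded (M := Clam) (by simp)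
    (h.rate_meas i).aestronglyMeasurable (Filter.Eventually.of_forall fun x => ?_)
  rw [Real.norm_of_nonneg (h.rate_nonneg i x)]
  exact h.rate_le i x

lemma Hyp.int_rate_eq (h : Hyp q d ts Clam lam Q fW) {i : ℕ} (hi : i ∈ Finset.Icc 1 q)
    {u : ℝ} (hu : 0 ≤ u) (F : ℝ → ℝ) :
    ∫ s in (0:ℝ)..(min u (ts i)), lam i s * Real.exp (-(Lam lam i s)) * F s
      = ∫ s in Set.Ioc 0 u, rate ts lam i s * F s := by
  have ht := h.ts_pos hi
  rw [intervalIntegral.integral_of_le (le_min hu ht.le)]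
  have e : (fun s => rate ts lam i s * F s) = (Set.Ioo 0 (ts i)).indicator
      (fun s => lam i s * Real.exp (-(Lam lam i s)) * F s) := by
    funext s
    unfold rate
    by_cases hs : s ∈ Set.Ioo 0 (ts i)
    · rw [Set.indicator_of_mem hs, Set.indicator_of_mem hs]
    · rw [Set.indicator_of_notMem hs, Set.indicator_of_notMem hs, zero_mul]
  rw [e, setIntegral_indicator measurableSet_Ioo]
  refine setIntegral_congr_set ?_
  have h1 : (Set.Ioc 0 (min u (ts i)) : Set ℝ) = Set.Ioc 0 u ∩ Set.Ioc 0 (ts i) := by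
    ext x; simp; tauto
  rw [h1]
  exact Filter.EventuallyEq.inter (Filter.EventuallyEq.refl _ _) Ioo_ae_eq_Ioc.symm

lemma Hyp.int_rate_le (h : Hyp q d ts Clam lam Q fW) {i : ℕ} (hi : i ∈ Finset.Icc 1 q)
    {u : ℝ} (hu : 0 ≤ u) :
    ∫ s in Set.Ioc 0 u, rate ts lam i s ≤ 1 - Real.exp (-(Lam lam i (min u (ts i)))) := by
  have e := h.int_rate_eq hi hu (fun _ => 1)
  simp only [mul_one] at e
  rw [← e]
  have hT : 0 ≤ min u (ts i) := le_min hu (h.ts_pos hi).le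
  generalize min u (ts i) = T at hT
  set f : ℝ → ℝ := fun t =>
    - Real.exp (-(∫ s in (0:ℝ)..t, (Set.Ici (0:ℝ)).indicator (lam i) s)) with hf
  have hmono : MonotoneOn f (Set.uIcc 0 T) := by
    intro a _ b _ hab
    simp only [hf, neg_le_neg_iff, Real.exp_le_exp]
    have : (∫ s in (0:ℝ)..b, (Set.Ici (0:ℝ)).indicator (lam i) s) -
      (∫ s in (0:ℝ)..a, (Set.Ici (0:ℝ)).indicator (lam i) s) =
        ∫ s in a..b, (Set.Ici (0:ℝ)).indicator (lam i) s :=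
      intervalIntegral.integral_interval_sub_left (h.lamInd_int i _ _) (h.lamInd_int i _ _)
    have h2 : 0 ≤ ∫ s in a..b, (Set.Ici (0:ℝ)).indicator (lam i) s :=
      intervalIntegral.integral_nonneg hab fun x _ =>
        Set.indicator_nonneg (fun x hx => (h.hlam_bd i x hx).1) x
    linarith
  have hm := hmono.intervalIntegral_deriv_mem_uIcc
  have hf0 : f 0 = -1 := by simp [hf]
  have hfT : f T = - Real.exp (-(Lam lam i T)) := by simp only [hf]; rw [h.Lam_eq i hT]
  have hle : 0 ≤ f T - f 0 := sub_nonneg.2 (hmono (by simp) (by simp) hT)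
  rw [Set.uIcc_of_le hle] at hm
  have hder := (h.lamInd_int i 0 T).ae_hasDerivAt_integral
  have : ∫ s in (0:ℝ)..T, lam i s * Real.exp (-(Lam lam i s)) = ∫ s in (0:ℝ)..T, deriv f s := by
    refine intervalIntegral.integral_congr_ae ?_
    filter_upwards [hder] with x hx hxT
    have hx' := hx (Set.uIoc_subset_uIcc hxT) 0 (by simp)
    rw [Set.uIoc_of_le hT] at hxT
    have := (hx'.neg.exp.neg).deriv
    rw [show deriv f x = _ from this, h.Lam_eq i hxT.1.le]
    simp [Set.indicator, hxT.1.le]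
    ring
  rw [this]
  have := hm.2
  rw [hf0, hfT] at this
  linarith

lemma Hyp.fW_integrable (h : Hyp q d ts Clam lam Q fW) (c : Fin d → ℝ) :
    Integrable (fun y => fW (y - c)) := by
  have : Integrable fW := .of_integral_ne_zero (by rw [h.hfW_int]; norm_num)
  exact this.comp_sub_right c

lemma Hyp.mk_integrable (h : Hyp q d ts Clam lam Q fW) (i : ℕ) (s : ℝ) :
    Integrable (mkd q d Q fW phi i s) := by
  unfold mkd
  exact integrable_finsetSum _ fun j _ => (h.fW_integrable (phi j)).const_mul _

lemma Hyp.mk_int (h : Hyp q d ts Clam lam Q fW) (i : ℕ) {s : ℝ} (hs : 0 ≤ s) :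
    ∫ y, mkd q d Q fW phi i s y = 1 := by
  unfold mkd
  rw [integral_finsetSum _ fun j _ => (h.fW_integrable (phi j)).const_mul _]
  simp_rw [integral_const_mul, integral_sub_right_eq_self, h.hfW_int, mul_one]
  exact h.hQ_sum i s hs

lemma Hyp.mk_nonneg (h : Hyp q d ts Clam lam Q fW) (i : ℕ) {s : ℝ} (hs : 0 ≤ s)
    (y : Fin d → ℝ) : 0 ≤ mkd q d Q fW phi i s y :=
  Finset.sum_nonneg fun j _ => mul_nonneg (h.hQ_bd i j s hs).1 (h.hfW_nonneg _)

lemma Hyp.mk_meas (h : Hyp q d ts Clam lam Q fW) (i : ℕ) :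
    Measurable (fun z : ℝ × (Fin d → ℝ) => mkd q d Q fW phi i z.1 z.2) := by
  unfold mkd
  refine Finset.measurable_fun_sum _ fun j _ => ?_
  exact ((h.hQ_meas i j).comp measurable_fst).mul
    (h.hfW_meas.comp (measurable_snd.sub_const _))

lemma At_eq (p : ℕ → ℝ) (y : Fin d → ℝ) (s : ℝ) :
    At q d ts lam Q fW phi p y s
      = ∑ i ∈ Finset.Icc 1 q, p i * rate ts lam i s * mkd q d Q fW phi i s y := by
  unfold At An mkd
  rw [Finset.sum_comm]
  refine Finset.sum_congr rfl fun i _ => ?_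
  rw [Finset.mul_sum]
  exact Finset.sum_congr rfl fun j _ => by ring

lemma rate_zero {i : ℕ} {s : ℝ} (hs : ¬ 0 < s) : rate ts lam i s = 0 := by
  unfold rate
  exact Set.indicator_of_notMem (fun hh => hs hh.1) _

lemma Hyp.An_nonneg (h : Hyp q d ts Clam lam Q fW) {p : ℕ → ℝ} (hp : mem1 q p)
    (y : Fin d → ℝ) (s : ℝ) (j : ℕ) : 0 ≤ An q d ts lam Q fW phi p y s j := by
  refine Finset.sum_nonneg fun i hi => ?_
  by_cases hs : 0 < s
  · exact mul_nonneg (mul_nonneg (mul_nonneg (hp.1 i hi) (h.rate_nonneg i s))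
      (h.hQ_bd i j s hs.le).1) (h.hfW_nonneg _)
  · simp [rate_zero hs]

lemma Hyp.At_nonneg (h : Hyp q d ts Clam lam Q fW) {p : ℕ → ℝ} (hp : mem1 q p)
    (y : Fin d → ℝ) (s : ℝ) : 0 ≤ At q d ts lam Q fW phi p y s :=
  Finset.sum_nonneg fun j _ => h.An_nonneg hp y s j

lemma Hyp.An_meas (h : Hyp q d ts Clam lam Q fW) (p : ℕ → ℝ) (j : ℕ) :
    Measurable (fun z : ℝ × (Fin d → ℝ) => An q d ts lam Q fW phi p z.2 z.1 j) := by
  unfold An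
  refine Finset.measurable_fun_sum _ fun i _ => ?_
  exact ((((h.rate_meas i).comp measurable_fst).const_mul _).mul
    ((h.hQ_meas i j).comp measurable_fst)).mul
    (h.hfW_meas.comp (measurable_snd.sub_const _))

lemma Hyp.At_meas (h : Hyp q d ts Clam lam Q fW) (p : ℕ → ℝ) :
    Measurable (fun z : ℝ × (Fin d → ℝ) => At q d ts lam Q fW phi p z.2 z.1) := by
  unfold At
  exact Finset.measurable_fun_sum _ fun j _ => h.An_meas p j

lemma Hyp.Bn_meas (h : Hyp q d ts Clam lam Q fW) (p : ℕ → ℝ) (j : ℕ) :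
    Measurable (fun z : ℝ × (Fin d → ℝ) => Bn q d ts lam Q fW phi p z.2 z.1 j) := by
  unfold Bn
  exact Measurable.ite (measurableSet_lt measurable_const (h.At_meas p))
    ((h.An_meas p j).div (h.At_meas p)) measurable_const

lemma Hyp.Bn_mem (h : Hyp q d ts Clam lam Q fW) {p : ℕ → ℝ} (hp : mem1 q p)
    (y : Fin d → ℝ) (s : ℝ) : mem1 q (Bn q d ts lam Q fW phi p y s) := by
  by_cases hA : 0 < At q d ts lam Q fW phi p y s
  · have : Bn q d ts lam Q fW phi p y s = fun j =>
        An q d ts lam Q fW phi p y s j / At q d ts lam Q fW phi p y s := by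
      funext j; simp [Bn, hA]
    rw [this]
    refine ⟨fun i _ => div_nonneg (h.An_nonneg hp y s i) hA.le, ?_⟩
    rw [← Finset.sum_div]
    exact div_self hA.ne'
  · have : Bn q d ts lam Q fW phi p y s = p := by funext j; simp [Bn, hA]
    rwa [this]

lemma Hyp.Bn_mul (h : Hyp q d ts Clam lam Q fW) {p : ℕ → ℝ} (hp : mem1 q p)
    (y : Fin d → ℝ) (s : ℝ) {j : ℕ} (hj : j ∈ Finset.Icc 1 q) :
    At q d ts lam Q fW phi p y s * Bn q d ts lam Q fW phi p y s j
      = An q d ts lam Q fW phi p y s j := by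
  by_cases hA : 0 < At q d ts lam Q fW phi p y s
  · simp only [Bn, hA, if_true]
    field_simp
  · have h0 : At q d ts lam Q fW phi p y s = 0 := le_antisymm (not_lt.1 hA) (h.At_nonneg hp y s)
    rw [h0, zero_mul]
    exact ((Finset.sum_eq_zero_iff_of_nonneg fun j _ => h.An_nonneg hp y s j).1 h0 j hj).symm

lemma Hyp.Psi_eq_Bn (h : Hyp q d ts Clam lam Q fW) (p : ℕ → ℝ) (y : Fin d → ℝ) {s : ℝ}
    (hs : 0 < s) (hsq : s < ts q) (hne : ∀ m ∈ Finset.Icc 1 q, s ≠ ts m) :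
    Psi q d ts lam Q fW phi p y s = Bn q d ts lam Q fW phi p y s := by
  classical
  have h1 : ¬ ∃ m, 1 ≤ m ∧ m ≤ q ∧ s = ts m := by
    rintro ⟨m, hm1, hm2, hm⟩
    exact hne m (Finset.mem_Icc.2 ⟨hm1, hm2⟩) hm
  have h2 : ∃ m, m < q ∧ ts m < s ∧ s < ts (m + 1) := by
    have hex : ∃ k, s < ts k := ⟨q, hsq⟩
    have hk := Nat.find_spec hex
    have hkq : Nat.find hex ≤ q := Nat.find_min' hex hsq
    have hk0 : Nat.find hex ≠ 0 := by
      intro h0; rw [h0, h.hts0] at hk; linarith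
    obtain ⟨m, hm⟩ := Nat.exists_eq_succ_of_ne_zero hk0
    have hmn : ¬ s < ts m := Nat.find_min hex (by omega)
    rw [hm] at hk hkq
    refine ⟨m, by omega, lt_of_le_of_ne (not_lt.1 hmn) ?_, hk⟩
    intro he
    rcases Nat.eq_zero_or_pos m with h0 | h0
    · rw [h0, h.hts0] at he; linarith
    · exact h1 ⟨m, h0, by omega, he.symm⟩
  have hm0 := Nat.sInf_mem (s := {m | m < q ∧ ts m < s ∧ s < ts (m + 1)}) h2
  unfold Psi
  rw [if_neg h1, if_pos h2]
  generalize sInf {m | m < q ∧ ts m < s ∧ s < ts (m + 1)} = m at hm0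
  obtain ⟨hmq, hml, hmu⟩ := hm0
  have hnum : ∀ j, psiNum q d ts lam Q fW phi m p y s j = An q d ts lam Q fW phi p y s j := by
    intro j
    unfold psiNum An
    have hsub : Finset.Icc (m + 1) q ⊆ Finset.Icc 1 q :=
      Finset.Icc_subset_Icc (by omega) le_rfl
    rw [← Finset.sum_subset hsub]
    · refine Finset.sum_congr rfl fun i hi => ?_
      rw [Finset.mem_Icc] at hi
      have : s < ts i := hmu.trans_le (h.ts_mono hi.1 hi.2)
      unfold rate
      have hsm : s ∈ Set.Ioo 0 (ts i) := ⟨hs, this⟩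
      rw [Set.indicator_of_mem hsm]
      ring
    · intro i hi hi'
      rw [Finset.mem_Icc] at hi hi'
      have : ts i ≤ ts m := h.ts_mono (by omega) hmq.le
      have : rate ts lam i s = 0 := by
        unfold rate
        exact Set.indicator_of_notMem (fun hh => by linarith [hh.2]) _
      simp [this]
  have hbar : psiBar q d ts lam Q fW phi m p y s = At q d ts lam Q fW phi p y s :=
    Finset.sum_congr rfl fun j _ => hnum j
  funext j
  simp only [hbar, hnum, Bn]
  split_ifs <;> rfl

/-- At a forced jump the filter is either independent of the prior or equal to it. -/
lemma Hyp.Psi_ts (h : Hyp q d ts Clam lam Q fW) {i : ℕ} (hi : i ∈ Finset.Icc 1 q) :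
    ∃ (S : (Fin d → ℝ) → ℝ) (D : (Fin d → ℝ) → ℕ → ℝ), Measurable S ∧
      (∀ j, Measurable fun y => D y j) ∧ (∀ y, 0 < S y → mem1 q (D y)) ∧
      (∀ p y, 0 < S y → Psi q d ts lam Q fW phi p y (ts i) = D y) ∧
      (∀ p y, ¬ 0 < S y → Psi q d ts lam Q fW phi p y (ts i) = p) := by
  have h1 : ∃ m, 1 ≤ m ∧ m ≤ q ∧ ts i = ts m := by
    rw [Finset.mem_Icc] at hi
    exact ⟨i, hi.1, hi.2, rfl⟩
  have hm := Nat.sInf_mem (s := {m | 1 ≤ m ∧ m ≤ q ∧ ts i = ts m}) h1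
  set m := sInf {m | 1 ≤ m ∧ m ≤ q ∧ ts i = ts m} with hmdef
  have htm : 0 ≤ ts m := (h.ts_pos (Finset.mem_Icc.2 ⟨hm.1, hm.2.1⟩)).le
  have hmeas : ∀ k, Measurable fun y => Q m k (ts m) * fW (y - phi k) := fun k =>
    (h.hfW_meas.comp (measurable_id.sub_const _)).const_mul _
  have hS : Measurable fun y => ∑ k ∈ Finset.Icc 1 q, Q m k (ts m) * fW (y - phi k) :=
    Finset.measurable_fun_sum _ fun k _ => hmeas k
  refine ⟨fun y => ∑ k ∈ Finset.Icc 1 q, Q m k (ts m) * fW (y - phi k),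
    fun y j => Q m j (ts m) * fW (y - phi j) /
        (∑ k ∈ Finset.Icc 1 q, Q m k (ts m) * fW (y - phi k)), hS,
    fun j => (hmeas j).div hS, ?_, ?_, ?_⟩
  · intro y hy
    refine ⟨fun j _ => div_nonneg (mul_nonneg (h.hQ_bd m j _ htm).1 (h.hfW_nonneg _)) hy.le, ?_⟩
    rw [← Finset.sum_div]
    exact div_self hy.ne'
  · intro p y hy
    unfold Psi
    rw [if_pos h1]
    exact if_pos hy
  · intro p y hy
    unfold Psi
    rw [if_pos h1]
    exact if_neg hy

/-- A function Lipschitz on the simplex composed with a measurable simplex-valued map. -/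
lemma meas_comp {α : Type*} [MeasurableSpace α] {v : (ℕ → ℝ) → ℝ} {K : ℝ} (hK : 0 ≤ K)
    (hv : ∀ p p', mem1 q p → mem1 q p' → |v p - v p'| ≤ K * l1 q p p')
    {B : α → ℕ → ℝ} (hB : ∀ j, Measurable fun a => B a j) (hBm : ∀ a, mem1 q (B a)) :
    Measurable fun a => v (B a) := by
  let ext : ((Finset.Icc 1 q) → ℝ) → ℕ → ℝ := fun x j =>
    if hj : j ∈ Finset.Icc 1 q then x ⟨j, hj⟩ else 0
  let res : (ℕ → ℝ) → ((Finset.Icc 1 q) → ℝ) := fun p j => p j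
  have hex : ∀ p, ∀ j ∈ Finset.Icc 1 q, ext (res p) j = p j := by
    intro p j hj
    simp only [ext, res, dif_pos hj]
  have hmem : ∀ p, mem1 q p → mem1 q (ext (res p)) := by
    intro p hp
    refine ⟨fun i hi => by rw [hex p i hi]; exact hp.1 i hi, ?_⟩
    rw [Finset.sum_congr rfl (hex p)]; exact hp.2
  have hveq : ∀ p, mem1 q p → v p = v (ext (res p)) := by
    intro p hp
    have := hv p _ hp (hmem p hp)
    have h0 : l1 q p (ext (res p)) = 0 := by
      unfold l1
      exact Finset.sum_eq_zero fun i hi => by rw [hex p i hi]; simp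
    rw [h0, mul_zero] at this
    exact sub_eq_zero.1 (abs_nonpos_iff.1 this)
  have hL : LipschitzOnWith (K * q).toNNReal (fun x => v (ext x)) {x | mem1 q (ext x)} := by
    refine LipschitzOnWith.of_dist_le_mul fun x hx x' hx' => ?_
    rw [Real.coe_toNNReal _ (by positivity), Real.dist_eq]
    refine (hv _ _ hx hx').trans ?_
    rw [mul_assoc]
    refine mul_le_mul_of_nonneg_left ?_ hK
    unfold l1
    calc _ ≤ ∑ i ∈ Finset.Icc 1 q, dist x x' := by
            refine Finset.sum_le_sum fun i hi => ?_
            simp only [ext, dif_pos hi]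
            exact dist_le_pi_dist x x' ⟨i, hi⟩
      _ = q * dist x x' := by simp
  obtain ⟨w, hw, hww⟩ := hL.extend_real
  have : (fun a => v (B a)) = fun a => w (res (B a)) := by
    funext a
    rw [hveq _ (hBm a)]
    exact hww (hmem _ (hBm a))
  rw [this]
  exact hw.continuous.measurable.comp (measurable_pi_lambda _ fun j => hB j)

lemma abs_int_le {α : Type*} [MeasurableSpace α] {μ : Measure α} {f b : α → ℝ}
    (hb : Integrable b μ) (hf : ∀ᵐ a ∂μ, |f a| ≤ b a) : |∫ a, f a ∂μ| ≤ ∫ a, b a ∂μ :=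
  by rw [← Real.norm_eq_abs]; exact norm_integral_le_of_norm_le hb hf

/-- Invariant of the dynamic programming recursion: `v` is bounded by `C` on the simplex, and its
positively homogeneous extension is `K`-Lipschitz on the cone. -/
structure Inv (q : ℕ) (v : (ℕ → ℝ) → ℝ) (C K : ℝ) : Prop where
  hC : 0 ≤ C
  hK : 0 ≤ K
  bd : ∀ p, mem1 q p → |v p| ≤ C
  cone : ∀ x y p p', 0 ≤ x → 0 ≤ y → mem1 q p → mem1 q p' →
    |x * v p - y * v p'| ≤ K * ∑ i ∈ Finset.Icc 1 q, |x * p i - y * p' i|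

variable {v : (ℕ → ℝ) → ℝ} {C K : ℝ}

lemma Inv.lip (hv : Inv q v C K) (p p' : ℕ → ℝ) (hp : mem1 q p) (hp' : mem1 q p') :
    |v p - v p'| ≤ K * l1 q p p' := by
  simpa [l1] using hv.cone 1 1 p p' zero_le_one zero_le_one hp hp'

lemma Hyp.vB_meas (h : Hyp q d ts Clam lam Q fW) (hv : Inv q v C K) {p : ℕ → ℝ}
    (hp : mem1 q p) :
    Measurable (fun z : ℝ × (Fin d → ℝ) => v (Bn q d ts lam Q fW phi p z.2 z.1)) :=
  meas_comp hv.hK hv.lip (fun j => h.Bn_meas p j) (fun z => h.Bn_mem hp z.2 z.1)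

lemma Hyp.vB_mk_integrable (h : Hyp q d ts Clam lam Q fW) (hv : Inv q v C K) {p : ℕ → ℝ}
    (hp : mem1 q p) (i : ℕ) (s : ℝ) :
    Integrable (fun y => v (Bn q d ts lam Q fW phi p y s) * mkd q d Q fW phi i s y) := by
  refine (h.mk_integrable i s).bdd_mul (c := C) ?_ ?_
  · exact ((h.vB_meas hv hp).comp measurable_prodMk_left).aestronglyMeasurable
  · exact Filter.Eventually.of_forall fun y => hv.bd _ (h.Bn_mem hp y s)

lemma Hyp.At_integrable (h : Hyp q d ts Clam lam Q fW) (p : ℕ → ℝ) (s : ℝ) :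
    Integrable (fun y => At q d ts lam Q fW phi p y s) := by
  simp_rw [At_eq]
  exact integrable_finsetSum _ fun i _ => (h.mk_integrable i s).const_mul _

lemma Hyp.At_int (h : Hyp q d ts Clam lam Q fW) (p : ℕ → ℝ) {s : ℝ} (hs : 0 ≤ s) :
    ∫ y, At q d ts lam Q fW phi p y s = ∑ i ∈ Finset.Icc 1 q, p i * rate ts lam i s := by
  simp_rw [At_eq]
  rw [integral_finsetSum _ fun i _ => (h.mk_integrable i s).const_mul _]
  simp_rw [integral_const_mul, h.mk_int _ hs, mul_one]

lemma Hyp.vB_At_integrable (h : Hyp q d ts Clam lam Q fW) (hv : Inv q v C K) {p : ℕ → ℝ}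
    (hp : mem1 q p) (s : ℝ) :
    Integrable (fun y => v (Bn q d ts lam Q fW phi p y s) * At q d ts lam Q fW phi p y s) := by
  refine (h.At_integrable p s).bdd_mul (c := C) ?_ ?_
  · exact ((h.vB_meas hv hp).comp measurable_prodMk_left).aestronglyMeasurable
  · exact Filter.Eventually.of_forall fun y => hv.bd _ (h.Bn_mem hp y s)

/-- Inner integral. -/
def Mn (q d : ℕ) (ts : ℕ → ℝ) (lam : ℕ → ℝ → ℝ) (Q : ℕ → ℕ → ℝ → ℝ)
    (fW : (Fin d → ℝ) → ℝ) (phi : ℕ → Fin d → ℝ) (v : (ℕ → ℝ) → ℝ) (p : ℕ → ℝ) (s : ℝ) : ℝ :=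
  ∫ y, v (Bn q d ts lam Q fW phi p y s) * At q d ts lam Q fW phi p y s

lemma Hyp.Mn_meas (h : Hyp q d ts Clam lam Q fW) (hv : Inv q v C K) {p : ℕ → ℝ}
    (hp : mem1 q p) : StronglyMeasurable (Mn q d ts lam Q fW phi v p) := by
  unfold Mn
  exact (((h.vB_meas hv hp).mul (h.At_meas p)).stronglyMeasurable).integral_prod_right

lemma Hyp.Fn_meas (h : Hyp q d ts Clam lam Q fW) (hv : Inv q v C K) {p : ℕ → ℝ}
    (hp : mem1 q p) (i : ℕ) : StronglyMeasurable (fun s =>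
      ∫ y, v (Bn q d ts lam Q fW phi p y s) * mkd q d Q fW phi i s y) :=
  (((h.vB_meas hv hp).mul (h.mk_meas i)).stronglyMeasurable).integral_prod_right

lemma Hyp.Fn_bd (h : Hyp q d ts Clam lam Q fW) (hv : Inv q v C K) {p : ℕ → ℝ}
    (hp : mem1 q p) (i : ℕ) {s : ℝ} (hs : 0 ≤ s) :
      |∫ y, v (Bn q d ts lam Q fW phi p y s) * mkd q d Q fW phi i s y| ≤ C := by
  have : C = ∫ y, C * mkd q d Q fW phi i s y := by
    rw [integral_const_mul, h.mk_int i hs, mul_one]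
  rw [this]
  refine abs_int_le ((h.mk_integrable i s).const_mul _)
    (Filter.Eventually.of_forall fun y => ?_)
  rw [abs_mul, abs_of_nonneg (h.mk_nonneg i hs y)]
  exact mul_le_mul_of_nonneg_right (hv.bd _ (h.Bn_mem hp y s)) (h.mk_nonneg i hs y)

lemma Hyp.Mn_bd (h : Hyp q d ts Clam lam Q fW) (hv : Inv q v C K) {p : ℕ → ℝ}
    (hp : mem1 q p) {s : ℝ} (hs : 0 ≤ s) :
    |Mn q d ts lam Q fW phi v p s| ≤ C * ∑ i ∈ Finset.Icc 1 q, p i * rate ts lam i s := by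
  rw [← h.At_int (phi := phi) p hs, ← integral_const_mul]
  refine abs_int_le ((h.At_integrable p s).const_mul _)
    (Filter.Eventually.of_forall fun y => ?_)
  rw [abs_mul, abs_of_nonneg (h.At_nonneg hp y s)]
  exact mul_le_mul_of_nonneg_right (hv.bd _ (h.Bn_mem hp y s)) (h.At_nonneg hp y s)

lemma Hyp.Mn_lip (h : Hyp q d ts Clam lam Q fW) (hv : Inv q v C K) {p p' : ℕ → ℝ}
    (hp : mem1 q p) (hp' : mem1 q p') {x x' : ℝ} (hx : 0 ≤ x) (hx' : 0 ≤ x')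
    {s : ℝ} (hs : 0 ≤ s) :
    |x * Mn q d ts lam Q fW phi v p s - x' * Mn q d ts lam Q fW phi v p' s|
      ≤ K * ∑ i ∈ Finset.Icc 1 q, |x * p i - x' * p' i| * rate ts lam i s := by
  rw [← h.At_int (phi := phi) (fun i => |x * p i - x' * p' i|) hs, ← integral_const_mul]
  unfold Mn
  rw [← integral_const_mul, ← integral_const_mul,
    ← integral_sub ((h.vB_At_integrable hv hp s).const_mul _)
      ((h.vB_At_integrable hv hp' s).const_mul _)]
  refine abs_int_le ((h.At_integrable _ s).const_mul _)
    (Filter.Eventually.of_forall fun y => ?_)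
  have hc := hv.cone (x * At q d ts lam Q fW phi p y s) (x' * At q d ts lam Q fW phi p' y s)
    _ _ (mul_nonneg hx (h.At_nonneg hp y s)) (mul_nonneg hx' (h.At_nonneg hp' y s))
    (h.Bn_mem (phi := phi) hp y s) (h.Bn_mem (phi := phi) hp' y s)
  calc _ = _ := by congr 1; ring
    _ ≤ _ := hc
    _ ≤ _ := by
      refine mul_le_mul_of_nonneg_left ?_ hv.hK
      unfold At
      refine Finset.sum_le_sum fun j hj => ?_
      have e1 := h.Bn_mul (phi := phi) hp y s hj
      have e2 := h.Bn_mul (phi := phi) hp' y s hj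
      unfold At at e1 e2
      rw [mul_assoc, e1, mul_assoc, e2]
      unfold An
      rw [Finset.mul_sum, Finset.mul_sum, ← Finset.sum_sub_distrib]
      refine (Finset.abs_sum_le_sum_abs _ _).trans (Finset.sum_le_sum fun i hi => ?_)
      by_cases hs0 : 0 < s
      · have hn : 0 ≤ rate ts lam i s * Q i j s * fW (y - phi j) :=
          mul_nonneg (mul_nonneg (h.rate_nonneg i s) (h.hQ_bd i j s hs).1) (h.hfW_nonneg _)
        rw [show x * (p i * rate ts lam i s * Q i j s * fW (y - phi j))
          - x' * (p' i * rate ts lam i s * Q i j s * fW (y - phi j))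
          = (x * p i - x' * p' i) * (rate ts lam i s * Q i j s * fW (y - phi j)) by ring,
          abs_mul, abs_of_nonneg hn]
        exact le_of_eq (by ring)
      · simp [rate_zero hs0]

lemma Hyp.Iop_eq (h : Hyp q d ts Clam lam Q fW) (hv : Inv q v C K) {p : ℕ → ℝ}
    (hp : mem1 q p) {u : ℝ} (hu : 0 ≤ u) :
    Iop q d ts lam Q fW phi v p u = ∫ s in Set.Ioc 0 u, Mn q d ts lam Q fW phi v p s := by
  unfold Iop
  have e1 : ∀ i ∈ Finset.Icc 1 q, (p i * ∫ s in (0:ℝ)..(min u (ts i)),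
      lam i s * Real.exp (-(Lam lam i s)) *
        ∫ y : Fin d → ℝ,
          v (Psi q d ts lam Q fW phi p y s) *
            ∑ j ∈ Finset.Icc 1 q, Q i j s * fW (y - phi j))
      = ∫ s in Set.Ioc 0 u, p i * (rate ts lam i s *
        ∫ y, v (Bn q d ts lam Q fW phi p y s) * mkd q d Q fW phi i s y) := by
    intro i hi
    rw [h.int_rate_eq hi hu, integral_const_mul]
    congr 1
    refine setIntegral_congr_ae measurableSet_Ioc ?_
    have hfin : (↑((Finset.Icc 1 q).image ts) : Set ℝ).Countable := Finset.countable_toSet _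
    filter_upwards [hfin.ae_notMem volume] with s hs hsu
    have hne : ∀ m ∈ Finset.Icc 1 q, s ≠ ts m := by
      intro m hm he
      exact hs (by rw [he]; exact Finset.mem_coe.2 (Finset.mem_image_of_mem _ hm))
    by_cases hq : s < ts q
    · simp_rw [h.Psi_eq_Bn p _ hsu.1 hq hne]
      rfl
    · have : rate ts lam i s = 0 := by
        unfold rate
        refine Set.indicator_of_notMem (fun hh => hq (hh.2.trans_le ?_)) _
        exact h.ts_mono (Finset.mem_Icc.1 hi).2 le_rfl
      rw [this, zero_mul, zero_mul]
  rw [Finset.sum_congr rfl e1, ← integral_finsetSum]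
  · refine setIntegral_congr_fun measurableSet_Ioc fun s hs => ?_
    simp only [Mn]
    simp_rw [At_eq, Finset.mul_sum]
    rw [integral_finsetSum]
    · refine Finset.sum_congr rfl fun i _ => ?_
      rw [← mul_assoc, ← integral_const_mul]
      congr 1
      funext y
      ring
    · intro i _
      refine ((h.vB_mk_integrable (phi := phi) hv hp i s).const_mul
        (p i * rate ts lam i s)).congr (Filter.Eventually.of_forall fun y => ?_)
      simp only
      ring
  · intro i _
    refine Integrable.const_mul ?_ _
    refine Measure.integrableOn_of_bounded (M := Clam * C) (by simp)
      ((h.rate_meas i).aestronglyMeasurable.mul (h.Fn_meas hv hp i).aestronglyMeasurable) ?_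
    refine (ae_restrict_iff' measurableSet_Ioc).2 (Filter.Eventually.of_forall fun s hs => ?_)
    rw [norm_mul, Real.norm_of_nonneg (h.rate_nonneg i s)]
    exact mul_le_mul (h.rate_le i s) (h.Fn_bd hv hp i hs.1.le) (norm_nonneg _) h.hClam

lemma Hyp.sum_rate_integrable (h : Hyp q d ts Clam lam Q fW) (c : ℕ → ℝ) (A u : ℝ) :
    IntegrableOn (fun s => A * ∑ i ∈ Finset.Icc 1 q, c i * rate ts lam i s) (Set.Ioc 0 u) :=
  (integrable_finsetSum _ fun i _ => (h.rate_integrable i u).const_mul _).const_mul _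

lemma Hyp.sum_rate_le (h : Hyp q d ts Clam lam Q fW) (c : ℕ → ℝ)
    (hc : ∀ i ∈ Finset.Icc 1 q, 0 ≤ c i) {A u : ℝ} (hA : 0 ≤ A) (hu : 0 ≤ u) :
    ∫ s in Set.Ioc 0 u, A * ∑ i ∈ Finset.Icc 1 q, c i * rate ts lam i s
      ≤ A * ∑ i ∈ Finset.Icc 1 q, c i * (1 - Real.exp (-(Lam lam i (min u (ts i))))) := by
  rw [integral_const_mul, integral_finsetSum _ fun i _ => (h.rate_integrable i u).const_mul _]
  refine mul_le_mul_of_nonneg_left (Finset.sum_le_sum fun i hi => ?_) hA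
  rw [integral_const_mul]
  exact mul_le_mul_of_nonneg_left (h.int_rate_le hi hu) (hc i hi)

lemma Hyp.Mn_integrable (h : Hyp q d ts Clam lam Q fW) (hv : Inv q v C K) {p : ℕ → ℝ}
    (hp : mem1 q p) (u : ℝ) : IntegrableOn (Mn q d ts lam Q fW phi v p) (Set.Ioc 0 u) := by
  refine Integrable.mono' (h.sum_rate_integrable p C u) (h.Mn_meas hv hp).aestronglyMeasurable ?_
  exact (ae_restrict_iff' measurableSet_Ioc).2
    (Filter.Eventually.of_forall fun s hs => h.Mn_bd hv hp hs.1.le)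

lemma Hyp.Iop_bd (h : Hyp q d ts Clam lam Q fW) (hv : Inv q v C K) {p : ℕ → ℝ}
    (hp : mem1 q p) {u : ℝ} (hu : 0 ≤ u) :
    |Iop q d ts lam Q fW phi v p u|
      ≤ C * ∑ i ∈ Finset.Icc 1 q, p i * (1 - Real.exp (-(Lam lam i (min u (ts i))))) := by
  rw [h.Iop_eq hv hp hu]
  refine le_trans ?_ (h.sum_rate_le p hp.1 hv.hC hu)
  refine abs_int_le (h.sum_rate_integrable p C u) ?_
  exact (ae_restrict_iff' measurableSet_Ioc).2
    (Filter.Eventually.of_forall fun s hs => h.Mn_bd hv hp hs.1.le)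

lemma Hyp.Iop_lip (h : Hyp q d ts Clam lam Q fW) (hv : Inv q v C K) {p p' : ℕ → ℝ}
    (hp : mem1 q p) (hp' : mem1 q p') {x x' : ℝ} (hx : 0 ≤ x) (hx' : 0 ≤ x')
    {u : ℝ} (hu : 0 ≤ u) :
    |x * Iop q d ts lam Q fW phi v p u - x' * Iop q d ts lam Q fW phi v p' u|
      ≤ K * ∑ i ∈ Finset.Icc 1 q, |x * p i - x' * p' i| := by
  rw [h.Iop_eq hv hp hu, h.Iop_eq hv hp' hu, ← integral_const_mul, ← integral_const_mul,
    ← integral_sub ((h.Mn_integrable hv hp u).const_mul _)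
      ((h.Mn_integrable hv hp' u).const_mul _)]
  have h1 := h.sum_rate_le (fun i => |x * p i - x' * p' i|) (fun i _ => abs_nonneg _) hv.hK hu
  refine le_trans (le_trans ?_ h1) ?_
  · refine abs_int_le (h.sum_rate_integrable _ K u) ?_
    exact (ae_restrict_iff' measurableSet_Ioc).2
      (Filter.Eventually.of_forall fun s hs => h.Mn_lip hv hp hp' hx hx' hs.1.le)
  · refine mul_le_mul_of_nonneg_left (Finset.sum_le_sum fun i _ => ?_) hv.hK
    refine mul_le_of_le_one_right (abs_nonneg _) ?_
    linarith [Real.exp_pos (-(Lam lam i (min u (ts i))))]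

lemma Hyp.Psi_ts_mem (h : Hyp q d ts Clam lam Q fW) {i : ℕ} (hi : i ∈ Finset.Icc 1 q)
    {p : ℕ → ℝ} (hp : mem1 q p) (y : Fin d → ℝ) :
    mem1 q (Psi q d ts lam Q fW phi p y (ts i)) := by
  obtain ⟨S, D, _, _, hm, h1, h2⟩ := h.Psi_ts (phi := phi) hi
  by_cases hS : 0 < S y
  · rw [h1 p y hS]; exact hm y hS
  · rw [h2 p y hS]; exact hp

lemma Hyp.vPsi_integrable (h : Hyp q d ts Clam lam Q fW) (hv : Inv q v C K) {i : ℕ}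
    (hi : i ∈ Finset.Icc 1 q) {p : ℕ → ℝ} (hp : mem1 q p) :
    Integrable (fun y => v (Psi q d ts lam Q fW phi p y (ts i)) *
      mkd q d Q fW phi i (ts i) y) := by
  classical
  refine (h.mk_integrable i (ts i)).bdd_mul (c := C) ?_ ?_
  · refine (meas_comp hv.hK hv.lip (fun j => ?_) (h.Psi_ts_mem hi hp)).aestronglyMeasurable
    obtain ⟨S, D, hS, hD, hm, h1, h2⟩ := h.Psi_ts (phi := phi) hi
    have : (fun y => Psi q d ts lam Q fW phi p y (ts i) j)
        = fun y => if 0 < S y then D y j else p j := by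
      funext y
      by_cases hy : 0 < S y
      · rw [h1 p y hy, if_pos hy]
      · rw [h2 p y hy, if_neg hy]
    rw [this]
    exact Measurable.ite (measurableSet_lt measurable_const hS) (hD j) measurable_const
  · exact Filter.Eventually.of_forall fun y => hv.bd _ (h.Psi_ts_mem hi hp y)

lemma Hyp.bTerm_bd (h : Hyp q d ts Clam lam Q fW) (hv : Inv q v C K) {i : ℕ}
    (hi : i ∈ Finset.Icc 1 q) {p : ℕ → ℝ} (hp : mem1 q p) :
    |bTerm q d ts lam Q fW phi v p i| ≤ C * (p i * Real.exp (-(Lam lam i (ts i)))) := by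
  have hts := (h.ts_pos hi).le
  have hn : 0 ≤ p i * Real.exp (-(Lam lam i (ts i))) :=
    mul_nonneg (hp.1 i hi) (Real.exp_pos _).le
  have : |∫ y, v (Psi q d ts lam Q fW phi p y (ts i)) * mkd q d Q fW phi i (ts i) y|
      ≤ ∫ y, C * mkd q d Q fW phi i (ts i) y := by
    refine abs_int_le ((h.mk_integrable i _).const_mul _)
      (Filter.Eventually.of_forall fun y => ?_)
    rw [abs_mul, abs_of_nonneg (h.mk_nonneg i hts y)]
    exact mul_le_mul_of_nonneg_right (hv.bd _ (h.Psi_ts_mem hi hp y)) (h.mk_nonneg i hts y)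
  rw [integral_const_mul, h.mk_int i hts, mul_one] at this
  unfold bTerm
  rw [abs_mul, abs_of_nonneg hn, mul_comm]
  exact mul_le_mul_of_nonneg_right this hn

lemma mem1.abs_sub_le {p p' : ℕ → ℝ} (hp : mem1 q p) (hp' : mem1 q p') (x x' : ℝ) :
    |x - x'| ≤ ∑ i ∈ Finset.Icc 1 q, |x * p i - x' * p' i| := by
  have : x - x' = ∑ i ∈ Finset.Icc 1 q, (x * p i - x' * p' i) := by
    rw [Finset.sum_sub_distrib, ← Finset.mul_sum, ← Finset.mul_sum, hp.2, hp'.2]; ring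
  rw [this]
  exact Finset.abs_sum_le_sum_abs _ _

lemma Hyp.bTerm_lip (h : Hyp q d ts Clam lam Q fW) (hv : Inv q v C K) {i : ℕ}
    (hi : i ∈ Finset.Icc 1 q) {p p' : ℕ → ℝ}
    (hp : mem1 q p) (hp' : mem1 q p') {x x' : ℝ} (hx : 0 ≤ x) (hx' : 0 ≤ x') :
    |x * bTerm q d ts lam Q fW phi v p i - x' * bTerm q d ts lam Q fW phi v p' i|
      ≤ C * |x * p i - x' * p' i|
        + p i * ((K + C) * ∑ k ∈ Finset.Icc 1 q, |x * p k - x' * p' k|) := by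
  have hts := (h.ts_pos hi).le
  set δ := ∑ k ∈ Finset.Icc 1 q, |x * p k - x' * p' k| with hδ
  have hδ0 : 0 ≤ δ := Finset.sum_nonneg fun k _ => abs_nonneg _
  set b := C * |x * p i - x' * p' i| + p i * ((K + C) * δ) with hb
  have hpi := hp.1 i hi
  have hC := hv.hC
  have hK := hv.hK
  have hb0 : 0 ≤ b := by positivity
  set E := Real.exp (-(Lam lam i (ts i))) with hE
  have hE0 : 0 ≤ E := (Real.exp_pos _).le
  have hE1 : E ≤ 1 := h.exp_le i hts
  have key : ∀ y, |x * p i * v (Psi q d ts lam Q fW phi p y (ts i))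
      - x' * p' i * v (Psi q d ts lam Q fW phi p' y (ts i))| ≤ b := by
    intro y
    obtain ⟨S, D, _, _, hm, h1, h2⟩ := h.Psi_ts (phi := phi) hi
    by_cases hS : 0 < S y
    · rw [h1 p y hS, h1 p' y hS, ← sub_mul, abs_mul, mul_comm]
      have := mul_le_mul_of_nonneg_right (hv.bd _ (hm y hS)) (abs_nonneg (x * p i - x' * p' i))
      have h3 : 0 ≤ p i * ((K + C) * δ) := by positivity
      linarith
    · rw [h2 p y hS, h2 p' y hS]
      have hc := hv.cone x x' p p' hx hx' hp hp'
      have hs := mem1.abs_sub_le hp hp' x x'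
      have hv' := hv.bd p' hp'
      rw [show x * p i * v p - x' * p' i * v p' = p i * (x * v p - x' * v p')
        + (v p' * (x * p i - x' * p' i) - p i * (v p' * (x - x'))) by ring]
      calc _ ≤ |p i * (x * v p - x' * v p')| + (|v p' * (x * p i - x' * p' i)|
            + |p i * (v p' * (x - x'))|) :=
              (abs_add_le _ _).trans (add_le_add le_rfl (abs_sub _ _))
        _ ≤ p i * (K * δ) + (C * |x * p i - x' * p' i| + p i * (C * δ)) := by
              rw [abs_mul, abs_mul, abs_mul, abs_mul, abs_of_nonneg hpi]
              gcongr
        _ = b := by rw [hb]; ring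
  have e : x * bTerm q d ts lam Q fW phi v p i - x' * bTerm q d ts lam Q fW phi v p' i
      = E * ∫ y, (x * p i * v (Psi q d ts lam Q fW phi p y (ts i))
      - x' * p' i * v (Psi q d ts lam Q fW phi p' y (ts i))) * mkd q d Q fW phi i (ts i) y := by
    have : (∫ y, (x * p i * v (Psi q d ts lam Q fW phi p y (ts i))
      - x' * p' i * v (Psi q d ts lam Q fW phi p' y (ts i))) * mkd q d Q fW phi i (ts i) y)
      = x * p i * (∫ y, v (Psi q d ts lam Q fW phi p y (ts i)) * mkd q d Q fW phi i (ts i) y)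
      - x' * p' i *
        (∫ y, v (Psi q d ts lam Q fW phi p' y (ts i)) * mkd q d Q fW phi i (ts i) y) := by
      rw [← integral_const_mul, ← integral_const_mul,
        ← integral_sub ((h.vPsi_integrable hv hi hp).const_mul _)
          ((h.vPsi_integrable hv hi hp').const_mul _)]
      congr 1
      funext y
      ring
    rw [this]
    unfold bTerm mkd
    ring
  rw [e, abs_mul, abs_of_nonneg hE0]
  have hI : |∫ y, (x * p i * v (Psi q d ts lam Q fW phi p y (ts i))
      - x' * p' i * v (Psi q d ts lam Q fW phi p' y (ts i))) * mkd q d Q fW phi i (ts i) y|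
      ≤ ∫ y, b * mkd q d Q fW phi i (ts i) y := by
    refine abs_int_le ((h.mk_integrable i _).const_mul _)
      (Filter.Eventually.of_forall fun y => ?_)
    rw [abs_mul, abs_of_nonneg (h.mk_nonneg i hts y)]
    exact mul_le_mul_of_nonneg_right (key y) (h.mk_nonneg i hts y)
  rw [integral_const_mul, h.mk_int i hts, mul_one] at hI
  calc _ ≤ 1 * b := mul_le_mul hE1 hI (abs_nonneg _) zero_le_one
    _ = b := one_mul b

lemma Hyp.Jop_bd (h : Hyp q d ts Clam lam Q fW) (hv : Inv q v C K) {g : ℕ → ℝ → ℝ}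
    (hg : ∀ i ∈ Finset.Icc 1 q, ∀ t, 0 ≤ t → |g i t| ≤ C) {p : ℕ → ℝ}
    (hp : mem1 q p) {u : ℝ} (hu : 0 ≤ u) :
    |Jop q d ts lam Q fW phi v g p u| ≤ C := by
  unfold Jop Gop Hop
  rw [add_left_comm, ← Finset.sum_add_distrib]
  have hC := hv.hC
  have hsum : |∑ i ∈ Finset.Icc 1 q,
      ((if u < ts i then p i * Real.exp (-(Lam lam i u)) * g i u else 0)
        + if ts i ≤ u then bTerm q d ts lam Q fW phi v p i else 0)|
      ≤ C * ∑ i ∈ Finset.Icc 1 q, p i * Real.exp (-(Lam lam i (min u (ts i)))) := by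
    rw [Finset.mul_sum]
    refine (Finset.abs_sum_le_sum_abs _ _).trans (Finset.sum_le_sum fun i hi => ?_)
    rcases lt_or_ge u (ts i) with hlt | hge
    · rw [if_pos hlt, if_neg (not_le.2 hlt), add_zero, min_eq_left hlt.le, abs_mul,
        abs_of_nonneg (mul_nonneg (hp.1 i hi) (Real.exp_pos _).le), mul_comm]
      exact mul_le_mul_of_nonneg_right (hg i hi u hu)
        (mul_nonneg (hp.1 i hi) (Real.exp_pos _).le)
    · rw [if_neg (not_lt.2 hge), if_pos hge, zero_add, min_eq_right hge]
      exact h.bTerm_bd hv hi hp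
  refine (abs_add_le _ _).trans ((add_le_add (h.Iop_bd hv hp hu) hsum).trans ?_)
  rw [← mul_add, ← Finset.sum_add_distrib]
  have : ∑ i ∈ Finset.Icc 1 q, (p i * (1 - Real.exp (-(Lam lam i (min u (ts i)))))
      + p i * Real.exp (-(Lam lam i (min u (ts i))))) = 1 := by
    refine Eq.trans (Finset.sum_congr rfl fun i _ => ?_) hp.2
    ring
  rw [this, mul_one]

lemma Hyp.Jop_lip (h : Hyp q d ts Clam lam Q fW) (hv : Inv q v C K) {g : ℕ → ℝ → ℝ}
    (hg : ∀ i ∈ Finset.Icc 1 q, ∀ t, 0 ≤ t → |g i t| ≤ C) {p p' : ℕ → ℝ}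
    (hp : mem1 q p) (hp' : mem1 q p') {x x' : ℝ} (hx : 0 ≤ x) (hx' : 0 ≤ x')
    {u : ℝ} (hu : 0 ≤ u) :
    |x * Jop q d ts lam Q fW phi v g p u - x' * Jop q d ts lam Q fW phi v g p' u|
      ≤ (2 * K + 3 * C) * ∑ i ∈ Finset.Icc 1 q, |x * p i - x' * p' i| := by
  unfold Jop Gop Hop
  rw [add_left_comm, ← Finset.sum_add_distrib, add_left_comm, ← Finset.sum_add_distrib]
  have hI := h.Iop_lip (phi := phi) hv hp hp' hx hx' hu
  set δ := ∑ i ∈ Finset.Icc 1 q, |x * p i - x' * p' i| with hδ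
  have hδ0 : 0 ≤ δ := Finset.sum_nonneg fun k _ => abs_nonneg _
  have hC := hv.hC
  have hK := hv.hK
  have hs : |x * ∑ i ∈ Finset.Icc 1 q,
      ((if u < ts i then p i * Real.exp (-(Lam lam i u)) * g i u else 0)
        + if ts i ≤ u then bTerm q d ts lam Q fW phi v p i else 0) -
      x' * ∑ i ∈ Finset.Icc 1 q,
      ((if u < ts i then p' i * Real.exp (-(Lam lam i u)) * g i u else 0)
        + if ts i ≤ u then bTerm q d ts lam Q fW phi v p' i else 0)|
      ≤ ∑ i ∈ Finset.Icc 1 q, (C * |x * p i - x' * p' i| + p i * ((K + C) * δ)) := by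
    rw [Finset.mul_sum, Finset.mul_sum, ← Finset.sum_sub_distrib]
    refine (Finset.abs_sum_le_sum_abs _ _).trans (Finset.sum_le_sum fun i hi => ?_)
    have hpi := hp.1 i hi
    rcases lt_or_ge u (ts i) with hlt | hge
    · simp only [if_pos hlt, if_neg (not_le.2 hlt), add_zero]
      rw [show x * (p i * Real.exp (-(Lam lam i u)) * g i u)
        - x' * (p' i * Real.exp (-(Lam lam i u)) * g i u)
        = (Real.exp (-(Lam lam i u)) * g i u) * (x * p i - x' * p' i) by ring, abs_mul, abs_mul,
        abs_of_nonneg (Real.exp_pos _).le]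
      have h1 : Real.exp (-(Lam lam i u)) * |g i u| ≤ C := by
        calc _ ≤ 1 * C := mul_le_mul (h.exp_le i hu) (hg i hi u hu) (abs_nonneg _) zero_le_one
          _ = C := one_mul C
      have h2 := mul_le_mul_of_nonneg_right h1 (abs_nonneg (x * p i - x' * p' i))
      have h3 : 0 ≤ p i * ((K + C) * δ) := by positivity
      linarith
    · simp only [if_neg (not_lt.2 hge), if_pos hge, zero_add]
      exact h.bTerm_lip hv hi hp hp' hx hx'
  have hs2 : ∑ i ∈ Finset.Icc 1 q, (C * |x * p i - x' * p' i| + p i * ((K + C) * δ))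
      = C * δ + (K + C) * δ := by
    rw [Finset.sum_add_distrib, ← Finset.mul_sum, ← Finset.sum_mul, hp.2, one_mul]
  rw [hs2] at hs
  rw [mul_add, mul_add, add_sub_add_comm]
  refine (abs_add_le _ _).trans ((add_le_add hI hs).trans ?_)
  have : 0 ≤ C * δ := mul_nonneg hC hδ0
  linarith

lemma Hyp.Lop_inv (h : Hyp q d ts Clam lam Q fW) (hv : Inv q v C K) {g : ℕ → ℝ → ℝ}
    (hg : ∀ i ∈ Finset.Icc 1 q, ∀ t, 0 ≤ t → |g i t| ≤ C) {w : (ℕ → ℝ) → ℝ}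
    (hw : ∀ p, mem1 q p → w p = Lop q d ts lam Q fW phi v g p) :
    Inv q w C (2 * K + 3 * C) := by
  have hC := hv.hC
  have hK := hv.hK
  have hne : Nonempty (Set.Ici (0:ℝ)) := ⟨⟨0, Set.mem_Ici.2 le_rfl⟩⟩
  have hbdd : ∀ p, mem1 q p → BddAbove (Set.range fun u : Set.Ici (0:ℝ) =>
      Jop q d ts lam Q fW phi v g p u.1) := by
    intro p hp
    refine ⟨C, ?_⟩
    rintro _ ⟨u, rfl⟩
    exact (abs_le.1 (h.Jop_bd hv hg hp u.2)).2
  have half : ∀ x x' p p', 0 ≤ x → 0 ≤ x' → mem1 q p → mem1 q p' →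
      x * w p - x' * w p' ≤ (2 * K + 3 * C) * ∑ i ∈ Finset.Icc 1 q, |x * p i - x' * p' i| := by
    intro x x' p p' hx hx' hp hp'
    rw [hw p hp, hw p' hp']
    unfold Lop
    rw [Real.mul_iSup_of_nonneg hx, sub_le_iff_le_add]
    refine ciSup_le fun u => ?_
    have h1 := (abs_le.1 (h.Jop_lip (phi := phi) hv hg hp hp' hx hx' u.2)).2
    have h2 := mul_le_mul_of_nonneg_left (le_ciSup (hbdd p' hp') u) hx'
    linarith
  refine ⟨hC, by positivity, fun p hp => ?_, fun x x' p p' hx hx' hp hp' => ?_⟩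
  · rw [hw p hp, abs_le]
    unfold Lop
    constructor
    · exact (abs_le.1 (h.Jop_bd hv hg hp le_rfl)).1.trans
        (le_ciSup (hbdd p hp) ⟨0, Set.mem_Ici.2 le_rfl⟩)
    · exact ciSup_le fun u => (abs_le.1 (h.Jop_bd hv hg hp u.2)).2
  · rw [abs_sub_le_iff]
    refine ⟨half x x' p p' hx hx' hp hp', ?_⟩
    have := half x' x p' p hx' hx hp' hp
    simp_rw [abs_sub_comm (x' * _)] at this
    exact this

lemma base_inv {g : ℕ → ℝ → ℝ} (hC : 0 ≤ C)
    (hg : ∀ i ∈ Finset.Icc 1 q, ∀ t, 0 ≤ t → |g i t| ≤ C) {w : (ℕ → ℝ) → ℝ}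
    (hw : ∀ p, mem1 q p → w p = ∑ i ∈ Finset.Icc 1 q, g i 0 * p i) :
    Inv q w C C := by
  refine ⟨hC, hC, fun p hp => ?_, fun x x' p p' hx hx' hp hp' => ?_⟩
  · rw [hw p hp]
    refine (Finset.abs_sum_le_sum_abs _ _).trans ?_
    calc _ ≤ ∑ i ∈ Finset.Icc 1 q, C * p i := by
          refine Finset.sum_le_sum fun i hi => ?_
          rw [abs_mul, abs_of_nonneg (hp.1 i hi)]
          exact mul_le_mul_of_nonneg_right (hg i hi 0 le_rfl) (hp.1 i hi)
      _ = C := by rw [← Finset.mul_sum, hp.2, mul_one]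
  · rw [hw p hp, hw p' hp', Finset.mul_sum, Finset.mul_sum, ← Finset.sum_sub_distrib,
      Finset.mul_sum]
    refine (Finset.abs_sum_le_sum_abs _ _).trans (Finset.sum_le_sum fun i hi => ?_)
    rw [show x * (g i 0 * p i) - x' * (g i 0 * p' i) = g i 0 * (x * p i - x' * p' i) by ring,
      abs_mul]
    exact mul_le_mul_of_nonneg_right (hg i hi 0 le_rfl) (abs_nonneg _)

end helpers

/-- **Proposition C.9 (Lipschitz continuity of the value functions).** -/
theorem value_function_lipschitz
    (q d : ℕ) (hq : 1 ≤ q) (hd : 1 ≤ d)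
    (ts : ℕ → ℝ) (hts0 : ts 0 = 0) (hts1 : 0 < ts 1)
    (htsmono : ∀ i, i < q → ts i ≤ ts (i + 1))
    (Clam : ℝ) (hClam : 0 ≤ Clam)
    (lam : ℕ → ℝ → ℝ) (hlam_meas : ∀ i, Measurable (lam i))
    (hlam_bd : ∀ i s, 0 ≤ s → lam i s ∈ Set.Icc 0 Clam)
    (Q : ℕ → ℕ → ℝ → ℝ) (hQ_meas : ∀ i j, Measurable (Q i j))
    (hQ_bd : ∀ i j s, 0 ≤ s → Q i j s ∈ Set.Icc (0:ℝ) 1)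
    (hQ_sum : ∀ i s, 0 ≤ s → ∑ j ∈ Finset.Icc 1 q, Q i j s = 1)
    (fW : (Fin d → ℝ) → ℝ) (hfW_meas : Measurable fW)
    (hfW_nonneg : ∀ y, 0 ≤ fW y) (hfW_int : ∫ y : Fin d → ℝ, fW y = 1)
    (phi : ℕ → Fin d → ℝ)
    (g : ℕ → ℝ → ℝ) (hg_meas : ∀ i, Measurable (g i))
    (Cg g2 : ℝ) (hCg : 0 ≤ Cg) (hg2 : 0 ≤ g2)
    (hg_bd : ∀ i ∈ Finset.Icc 1 q, ∀ t, 0 ≤ t → |g i t| ≤ Cg)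
    (hg_lip : ∀ i ∈ Finset.Icc 1 q, ∀ t u, t ∈ Set.Icc 0 (ts i) → u ∈ Set.Icc 0 (ts i) →
      |g i t - g i u| ≤ g2 * |t - u|)
    (N : ℕ) (V : ℕ → (ℕ → ℝ) → ℝ)
    (hVN : ∀ p, mem1 q p → V N p = ∑ i ∈ Finset.Icc 1 q, g i 0 * p i)
    (hVrec : ∀ n, 1 ≤ n → n ≤ N → ∀ p, mem1 q p →
      V (n - 1) p = Lop q d ts lam Q fW phi (V n) g p) :
    ∀ n ≤ N, ∀ p p', mem1 q p → mem1 q p' →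
      |V n p - V n p'| ≤ ((2:ℝ) ^ (N - n + 2) - 3) * Cg * l1 q p p' := by
  have H : Hyp q d ts Clam lam Q fW :=
    ⟨hq, hts0, hts1, htsmono, hClam, hlam_meas, hlam_bd, hQ_meas, hQ_bd, hQ_sum, hfW_meas,
      hfW_nonneg, hfW_int⟩
  have main : ∀ k, k ≤ N → Inv q (V (N - k)) Cg (((2:ℝ) ^ (k + 2) - 3) * Cg) := by
    intro k
    induction k with
    | zero =>
      intro _
      have := base_inv hCg hg_bd hVN
      norm_num
      exact this
    | succ k ih =>
      intro hk
      have hv := ih (by omega)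
      have := H.Lop_inv (phi := phi) hv hg_bd (w := V (N - (k + 1))) (by
        intro p hp
        have := hVrec (N - k) (by omega) (by omega) p hp
        rwa [Nat.sub_sub] at this)
      convert this using 1
      ring
  intro n hn p p' hp hp'
  have := (main (N - n) (by omega)).lip p p' hp hp'
  rwa [Nat.sub_sub_self hn] at this

end PDMP
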